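/- For every prime p > 2, not every 3-dimensional F_p-subspace of ⋀²(F_p^4) is spanned by decomposables; nevertheless, writing R(p) for the ratio (number of 3-dimensional F_p-subspaces of ⋀²(F_p^4) spanned by decomposables) / (number of all 3-dimensional F_p-subspaces of ⋀²(F_p^4)), one has lim over primes p → ∞ of R(p)/(1 − 1/p) = 1. -/

import Mathlib

open Module Filter

noncomputable section

variable (K : Type*) [CommRing K] (V : Type*) [AddCommGroup V] [Module K V]

/-- The set of decomposable elements of the exterior square, viewed inside the
exterior algebra: elements of the form `v ∧ w`. -/
def DecompSet : Set (ExteriorAlgebra K V) :=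
  {x | ∃ v w : V, x = ExteriorAlgebra.ι K v * ExteriorAlgebra.ι K w}

/-- The second exterior power `⋀² V`, realised as the span of all decomposable
wedges inside the exterior algebra. -/
def grade2 : Submodule K (ExteriorAlgebra K V) := Submodule.span K (DecompSet K V)

/-- A subspace `L ≤ ⋀² V` is spanned by decomposables if it equals the span of the
set of decomposable elements contained in it. -/
def SpannedByDecomposables (L : Submodule K (ExteriorAlgebra K V)) : Prop :=
  L = Submodule.span K ((L : Set (ExteriorAlgebra K V)) ∩ DecompSet K V)

/-- The number of `r`-dimensional subspaces of `⋀²(F_p^d)` that are spanned by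
decomposables. -/
def numSpanned (p d r : ℕ) : ℕ :=
  Nat.card {L : Submodule (ZMod p) (ExteriorAlgebra (ZMod p) (Fin d → ZMod p)) //
    L ≤ grade2 (ZMod p) (Fin d → ZMod p) ∧ finrank (ZMod p) L = r ∧
    SpannedByDecomposables (ZMod p) (Fin d → ZMod p) L}

/-- The number of all `r`-dimensional subspaces of `⋀²(F_p^d)`. -/
def numAll (p d r : ℕ) : ℕ :=
  Nat.card {L : Submodule (ZMod p) (ExteriorAlgebra (ZMod p) (Fin d → ZMod p)) //
    L ≤ grade2 (ZMod p) (Fin d → ZMod p) ∧ finrank (ZMod p) L = r}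

/-- The proportion of `r`-dimensional subspaces of `⋀²(F_p^d)` that are spanned
by decomposables. -/
def decompRatio (p d r : ℕ) : ℝ := (numSpanned p d r : ℝ) / (numAll p d r : ℝ)

/-- The filter of primes tending to infinity. -/
def primesAtTop : Filter ℕ := atTop ⊓ 𝓟 {p : ℕ | p.Prime}

section Klein

/-- The Plücker coordinates of `v ∧ w`, in the order `01, 02, 03, 12, 13, 23`. -/
def pluckerCoord {R : Type*} [CommRing R] (v w : Fin 4 → R) : Fin 6 → R :=
  ![v 0 * w 1 - v 1 * w 0, v 0 * w 2 - v 2 * w 0, v 0 * w 3 - v 3 * w 0,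
    v 1 * w 2 - v 2 * w 1, v 1 * w 3 - v 3 * w 1, v 2 * w 3 - v 3 * w 2]

/-- The Klein quadratic form on Plücker coordinates. -/
def klein {R : Type*} [CommRing R] (x : Fin 6 → R) : R :=
  x 0 * x 5 - x 1 * x 4 + x 2 * x 3

/-- The polar form of the Klein quadratic form. -/
def kleinPolar {R : Type*} [CommRing R] (x y : Fin 6 → R) : R :=
  x 0 * y 5 + x 5 * y 0 - (x 1 * y 4 + x 4 * y 1) + (x 2 * y 3 + x 3 * y 2)

/-- The Gram matrix of a triple for the polar form. -/
def kleinGram {R : Type*} [CommRing R] (s : Fin 3 → Fin 6 → R) : Matrix (Fin 3) (Fin 3) R :=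
  Matrix.of fun i j => kleinPolar (s i) (s j)

theorem klein_pluckerCoord {R : Type*} [CommRing R] (v w : Fin 4 → R) :
    klein (pluckerCoord v w) = 0 := by
  simp [klein, pluckerCoord]
  ring

theorem exists_pluckerCoord_of_klein_eq_zero {F : Type*} [Field F] {x : Fin 6 → F}
    (hx : klein x = 0) : ∃ v w, x = pluckerCoord v w := by
  by_cases h0 : x 0 = 0
  · by_cases h1 : x 1 = 0
    · by_cases h2 : x 2 = 0
      · by_cases h3 : x 3 = 0
        · by_cases h4 : x 4 = 0
          · refine ⟨![0, 0, 1, 0], ![0, 0, 0, x 5], ?_⟩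
            ext i
            fin_cases i <;> simp [pluckerCoord, *]
          · refine ⟨![0, 1, x 5 / x 4, 0], ![0, 0, 0, x 4], ?_⟩
            ext i
            fin_cases i <;> simp [pluckerCoord, *]
        · refine ⟨![0, 1, 0, - x 5 / x 3], ![0, 0, x 3, x 4], ?_⟩
          ext i
          fin_cases i <;> simp [pluckerCoord, *]
      · have h3 : x 3 = 0 := by simpa [klein, h0, h1, h2] using hx
        refine ⟨![1, x 4 / x 2, x 5 / x 2, 0], ![0, 0, 0, x 2], ?_⟩
        ext i
        fin_cases i <;> simp [pluckerCoord, *]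
    · have h4 : x 4 = x 2 * x 3 / x 1 := by
        field_simp
        simp only [klein, h0] at hx
        linear_combination -hx
      refine ⟨![1, x 3 / x 1, 0, - x 5 / x 1], ![0, 0, x 1, x 2], ?_⟩
      ext i
      fin_cases i <;> simp [pluckerCoord, *]
      field_simp
  · have h5 : x 5 = (x 1 * x 4 - x 2 * x 3) / x 0 := by
      field_simp
      simp only [klein] at hx
      linear_combination hx
    refine ⟨![1, 0, - x 3 / x 0, - x 4 / x 0], ![0, x 0, x 1, x 2], ?_⟩
    ext i
    fin_cases i <;> simp [pluckerCoord, *]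
    field_simp
    ring

theorem klein_add_smul {R : Type*} [CommRing R] (x y : Fin 6 → R) (t : R) :
    klein (x + t • y) = klein x + t * kleinPolar x y + t ^ 2 * klein y := by
  simp [klein, kleinPolar]
  ring

/-- The polar form as a linear map in its first argument. -/
def kleinPolarLeft {R : Type*} [CommRing R] (y : Fin 6 → R) : (Fin 6 → R) →ₗ[R] R where
  toFun x := kleinPolar x y
  map_add' x x' := by simp [kleinPolar]; ring
  map_smul' t x := by simp [kleinPolar]; ring

theorem kleinPolar_comm {R : Type*} [CommRing R] (x y : Fin 6 → R) :
    kleinPolar x y = kleinPolar y x := by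
  simp only [kleinPolar]
  ring

theorem kleinPolar_sum {R : Type*} [CommRing R] (s : Fin 3 → Fin 6 → R) (c : Fin 3 → R)
    (i : Fin 3) : kleinPolar (s i) (∑ j, c j • s j) = (kleinGram s).mulVec c i := by
  rw [kleinPolar_comm]
  change kleinPolarLeft (s i) _ = _
  simp only [map_sum, map_smul, Matrix.mulVec, dotProduct, kleinGram, Matrix.of_apply]
  refine Finset.sum_congr rfl fun j _ => ?_
  simp [kleinPolarLeft, kleinPolar_comm (s i), mul_comm]

theorem linearIndependent_of_det_kleinGram_ne_zero {F : Type*} [Field F]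
    {s : Fin 3 → Fin 6 → F} (hs : (kleinGram s).det ≠ 0) : LinearIndependent F s := by
  rw [Fintype.linearIndependent_iff]
  intro c hc
  have : (kleinGram s).mulVec c = 0 := by
    ext i
    rw [← kleinPolar_sum, hc]
    simp [kleinPolar]
  exact congrFun (Matrix.eq_zero_of_mulVec_eq_zero hs this)

/-- A subspace containing a singular vector outside its radical is spanned by singular vectors. -/
theorem le_span_klein_eq_zero {F : Type*} [Field F] {M : Submodule F (Fin 6 → F)}
    {v w : Fin 6 → F} (hv : v ∈ M) (hv0 : klein v = 0) (hw : w ∈ M) (hvw : kleinPolar w v ≠ 0) :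
    M ≤ Submodule.span F ((M : Set (Fin 6 → F)) ∩ {x | klein x = 0}) := by
  have key : ∀ u ∈ M, kleinPolar u v ≠ 0 →
      u ∈ Submodule.span F ((M : Set (Fin 6 → F)) ∩ {x | klein x = 0}) := by
    intro u hu huv
    set t := -klein u / kleinPolar u v
    have h1 : u + t • v ∈ Submodule.span F ((M : Set (Fin 6 → F)) ∩ {x | klein x = 0}) := by
      refine Submodule.subset_span ⟨M.add_mem hu (M.smul_mem t hv), ?_⟩
      simp only [Set.mem_ofPred_eq, klein_add_smul, hv0, t]
      field_simp
      ring
    have h2 : v ∈ Submodule.span F ((M : Set (Fin 6 → F)) ∩ {x | klein x = 0}) :=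
      Submodule.subset_span ⟨hv, hv0⟩
    simpa using Submodule.sub_mem _ h1 (Submodule.smul_mem _ t h2)
  intro u hu
  by_cases huv : kleinPolar u v = 0
  · have h : u + w ∈ Submodule.span F ((M : Set (Fin 6 → F)) ∩ {x | klein x = 0}) := by
      refine key _ (M.add_mem hu hw) ?_
      have : kleinPolar (u + w) v = kleinPolar u v + kleinPolar w v :=
        map_add (kleinPolarLeft v) u w
      rwa [this, huv, zero_add]
    simpa using Submodule.sub_mem _ h (key w hw hvw)
  · exact key u hu huv

theorem exists_klein_sum_eq_zero {F : Type*} [Field F] [Finite F] (s : Fin 3 → Fin 6 → F) :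
    ∃ c : Fin 3 → F, c ≠ 0 ∧ klein (∑ j, c j • s j) = 0 := by
  classical
  cases nonempty_fintype F
  let y : Fin 6 → MvPolynomial (Fin 3) F := fun k =>
    ∑ j, MvPolynomial.C (s j k) * MvPolynomial.X j
  have hy : ∀ k, (y k).IsHomogeneous 1 := fun k =>
    MvPolynomial.IsHomogeneous.sum _ _ _ fun j _ => MvPolynomial.isHomogeneous_C_mul_X _ _
  have hdeg : (klein y).totalDegree < Fintype.card (Fin 3) := by
    have : (klein y).IsHomogeneous 2 :=
      (((hy 0).mul (hy 5)).sub ((hy 1).mul (hy 4))).add ((hy 2).mul (hy 3))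
    simpa using this.totalDegree_le.trans_lt (by norm_num)
  have heval : ∀ c : Fin 3 → F,
      MvPolynomial.eval c (klein y) = klein (∑ j, c j • s j) := by
    intro c
    simp [klein, y, mul_comm]
  obtain ⟨p, hp⟩ := CharP.exists F
  have hpp : p.Prime :=
    (CharP.char_is_prime_or_zero F p).resolve_right (CharP.char_ne_zero_of_finite F p)
  have hdvd := char_dvd_card_solutions p hdeg
  have hlt : 1 < Fintype.card {c : Fin 3 → F // MvPolynomial.eval c (klein y) = 0} :=
    hpp.one_lt.trans_le
      (Nat.le_of_dvd (Fintype.card_pos_iff.2 ⟨⟨0, by rw [heval]; simp [klein]⟩⟩) hdvd)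
  obtain ⟨⟨c, hc⟩, hne⟩ := Fintype.exists_ne_of_one_lt_card hlt ⟨0, by rw [heval]; simp [klein]⟩
  exact ⟨c, fun h => hne (Subtype.ext h), by rw [← heval, hc]⟩

theorem span_eq_span_klein_eq_zero {F : Type*} [Field F] [Finite F]
    {s : Fin 3 → Fin 6 → F} (hs : (kleinGram s).det ≠ 0) :
    Submodule.span F (Set.range s) = Submodule.span F
      ((Submodule.span F (Set.range s) : Set (Fin 6 → F)) ∩ {x | klein x = 0}) := by
  obtain ⟨c, hc0, hc⟩ := exists_klein_sum_eq_zero s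
  have hmul : (kleinGram s).mulVec c ≠ 0 := fun h => hc0 (Matrix.eq_zero_of_mulVec_eq_zero hs h)
  obtain ⟨i, hi⟩ := Function.ne_iff.1 hmul
  rw [← kleinPolar_sum] at hi
  refine le_antisymm (le_span_klein_eq_zero (Submodule.sum_mem _ fun j _ =>
    Submodule.smul_mem _ _ (Submodule.subset_span ⟨j, rfl⟩)) hc
    (Submodule.subset_span ⟨i, rfl⟩) hi) ?_
  exact Submodule.span_le.2 Set.inter_subset_left

/-- Over a finite field of odd characteristic, the Gram matrix is singular for a proportion of at
most `6 / q` of the triples of vectors. -/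
theorem card_det_kleinGram_eq_zero_le {F : Type*} [Field F] [Finite F] (h2 : (2 : F) ≠ 0) :
    Nat.card {s : Fin 3 → Fin 6 → F // (kleinGram s).det = 0} ≤ 6 * Nat.card F ^ 17 := by
  classical
  cases nonempty_fintype F
  let Y : Fin 3 → Fin 6 → MvPolynomial (Fin (3 * 6)) F := fun i k =>
    MvPolynomial.X (finProdFinEquiv (i, k))
  let e : (Fin 3 → Fin 6 → F) ≃ (Fin (3 * 6) → F) :=
    (Equiv.curry (Fin 3) (Fin 6) F).symm.trans (Equiv.arrowCongr finProdFinEquiv (Equiv.refl F))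
  have he : ∀ s i k, e s (finProdFinEquiv (i, k)) = s i k := fun s i k => by simp [e]
  have heval : ∀ s, MvPolynomial.eval (e s) (kleinGram Y).det = (kleinGram s).det := by
    intro s
    rw [RingHom.map_det]
    congr 1
    ext i j
    simp [kleinGram, kleinPolar, Y, he]
  have hG : ∀ i j, (kleinGram Y i j).IsHomogeneous 2 := by
    have hY : ∀ i k, (Y i k).IsHomogeneous 1 := fun i k => MvPolynomial.isHomogeneous_X _ _
    intro i j
    exact ((((hY i 0).mul (hY j 5)).add ((hY i 5).mul (hY j 0))).sub
      (((hY i 1).mul (hY j 4)).add ((hY i 4).mul (hY j 1)))).add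
      (((hY i 2).mul (hY j 3)).add ((hY i 3).mul (hY j 2)))
  have hdeg : (kleinGram Y).det.totalDegree ≤ 6 := by
    have h3 : ∀ a b c d e f, (kleinGram Y a b * kleinGram Y c d * kleinGram Y e f).IsHomogeneous 6 :=
      fun a b c d e f => ((hG a b).mul (hG c d)).mul (hG e f)
    rw [Matrix.det_fin_three]
    exact ((((((h3 _ _ _ _ _ _).sub (h3 _ _ _ _ _ _)).sub (h3 _ _ _ _ _ _)).add
      (h3 _ _ _ _ _ _)).add (h3 _ _ _ _ _ _)).sub (h3 _ _ _ _ _ _)).totalDegree_le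
  have hne : (kleinGram Y).det ≠ 0 := by
    intro h
    have := heval ![![1, 0, 0, 0, 0, 1], ![0, 1, 0, 0, 1, 0], ![0, 0, 1, 1, 0, 0]]
    rw [h, map_zero, Matrix.det_fin_three] at this
    simp [kleinGram, kleinPolar] at this
    apply h2
    rcases this with (h | h) | h
    · linear_combination h
    · linear_combination -h
    · linear_combination h
  have hSZ := MvPolynomial.schwartz_zippel_totalDegree hne (Finset.univ : Finset F)
  have hcard : Nat.card {s : Fin 3 → Fin 6 → F // (kleinGram s).det = 0} =
      (Finset.univ.filter fun x : Fin (3 * 6) → F =>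
        MvPolynomial.eval x (kleinGram Y).det = 0).card := by
    rw [← Fintype.card_subtype, ← Nat.card_eq_fintype_card]
    exact Nat.card_congr (e.subtypeEquiv fun s => by rw [heval])
  rw [hcard, Nat.card_eq_fintype_card]
  have hq : (0 : ℚ≥0) < Fintype.card F := by exact_mod_cast Fintype.card_pos
  rw [Fintype.piFinset_univ, Finset.card_univ, div_le_div_iff₀ (by positivity) hq] at hSZ
  have h6 : ((kleinGram Y).det.totalDegree : ℚ≥0) ≤ 6 := by exact_mod_cast hdeg
  have hle := hSZ.trans (mul_le_mul_of_nonneg_right h6 (by positivity))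
  have : ((Finset.univ.filter fun x : Fin (3 * 6) → F =>
        MvPolynomial.eval x (kleinGram Y).det = 0).card : ℚ≥0) ≤ 6 * (Fintype.card F : ℚ≥0) ^ 17 := by
    refine le_of_mul_le_mul_right (hle.trans_eq ?_) hq
    ring
  exact_mod_cast this

end Klein

section Exterior

/-- The alternating map sending `v, w` to the Plücker coordinates of `v ∧ w`. -/
def pluckerAlternating (R : Type*) [CommRing R] :
    (Fin 4 → R) [⋀^Fin 2]→ₗ[R] (Fin 6 → R) where
  toFun m := pluckerCoord (m 0) (m 1)
  map_update_add' m i x y := by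
    fin_cases i <;> ext k <;> fin_cases k <;> simp [pluckerCoord, Function.update] <;> ring
  map_update_smul' m i c x := by
    fin_cases i <;> ext k <;> fin_cases k <;> simp [pluckerCoord, Function.update] <;> ring
  map_eq_zero_of_eq' m i j hm hij := by
    have h : m 0 = m 1 := by
      fin_cases i <;> fin_cases j <;> first | exact absurd rfl hij | exact hm | exact hm.symm
    ext k
    fin_cases k <;> simp [pluckerCoord, h] <;> ring

/-- The Plücker coordinates of the degree-two part, as a linear map on the exterior algebra. -/
def exteriorCoord (R : Type*) [CommRing R] :
    ExteriorAlgebra R (Fin 4 → R) →ₗ[R] (Fin 6 → R) :=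
  ExteriorAlgebra.liftAlternating (Pi.single 2 (pluckerAlternating R))

/-- The element of the exterior square with given Plücker coordinates. -/
def ofPlucker (R : Type*) [CommRing R] :
    (Fin 6 → R) →ₗ[R] ExteriorAlgebra R (Fin 4 → R) :=
  let e : Fin 4 → ExteriorAlgebra R (Fin 4 → R) := fun i => ExteriorAlgebra.ι R (Pi.single i 1)
  Fintype.linearCombination R ![e 0 * e 1, e 0 * e 2, e 0 * e 3, e 1 * e 2, e 1 * e 3, e 2 * e 3]

theorem exteriorCoord_ι_mul_ι {R : Type*} [CommRing R] (v w : Fin 4 → R) :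
    exteriorCoord R (ExteriorAlgebra.ι R v * ExteriorAlgebra.ι R w) = pluckerCoord v w := by
  have h : ExteriorAlgebra.ι R v * ExteriorAlgebra.ι R w = ExteriorAlgebra.ιMulti R 2 ![v, w] := by
    simp [ExteriorAlgebra.ιMulti_apply]
  rw [h, exteriorCoord, ExteriorAlgebra.liftAlternating_apply_ιMulti, Pi.single_eq_same]
  rfl

theorem ofPlucker_pluckerCoord {R : Type*} [CommRing R] (v w : Fin 4 → R) :
    ofPlucker R (pluckerCoord v w) = ExteriorAlgebra.ι R v * ExteriorAlgebra.ι R w := by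
  have hexp : ∀ v : Fin 4 → R, ExteriorAlgebra.ι R v =
      ∑ i, v i • ExteriorAlgebra.ι R (Pi.single i 1 : Fin 4 → R) := by
    intro v
    conv_lhs => rw [pi_eq_sum_univ' v]
    simp [map_sum, map_smul]
  rw [hexp v, hexp w]
  have hsq : ∀ i : Fin 4, ExteriorAlgebra.ι R (Pi.single i 1 : Fin 4 → R) *
      ExteriorAlgebra.ι R (Pi.single i 1) = 0 := fun i => ExteriorAlgebra.ι_sq_zero _
  have hsw : ∀ i j : Fin 4, ExteriorAlgebra.ι R (Pi.single i 1 : Fin 4 → R) *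
      ExteriorAlgebra.ι R (Pi.single j 1) = -(ExteriorAlgebra.ι R (Pi.single j 1 : Fin 4 → R) *
      ExteriorAlgebra.ι R (Pi.single i 1)) :=
    fun i j => eq_neg_of_add_eq_zero_left (ExteriorAlgebra.ι_add_mul_swap _ _)
  simp only [ofPlucker, Fintype.linearCombination_apply, pluckerCoord, Fin.sum_univ_succ,
    Fin.sum_univ_zero, mul_add, add_mul, smul_mul_smul_comm]
  simp [hsq, hsw 1 0, hsw 2 0, hsw 3 0, hsw 2 1, hsw 3 1, hsw 3 2]
  module

theorem exteriorCoord_ofPlucker {R : Type*} [CommRing R] (x : Fin 6 → R) :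
    exteriorCoord R (ofPlucker R x) = x := by
  simp only [ofPlucker, Fintype.linearCombination_apply, Fin.sum_univ_succ, map_add, map_smul,
    Fin.sum_univ_zero]
  ext k
  fin_cases k <;> simp [exteriorCoord_ι_mul_ι, pluckerCoord]

theorem ofPlucker_injective (R : Type*) [CommRing R] : Function.Injective (ofPlucker R) :=
  Function.LeftInverse.injective exteriorCoord_ofPlucker

theorem range_ofPlucker (R : Type*) [CommRing R] :
    LinearMap.range (ofPlucker R) = grade2 R (Fin 4 → R) := by
  apply le_antisymm
  · rw [ofPlucker, Fintype.range_linearCombination, grade2]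
    refine Submodule.span_mono ?_
    rintro _ ⟨i, rfl⟩
    fin_cases i <;> exact ⟨_, _, rfl⟩
  · rw [grade2, Submodule.span_le]
    rintro _ ⟨v, w, rfl⟩
    exact ⟨_, ofPlucker_pluckerCoord v w⟩

theorem ofPlucker_image_klein_eq_zero (F : Type*) [Field F] :
    ofPlucker F '' {x | klein x = 0} = DecompSet F (Fin 4 → F) := by
  ext y
  constructor
  · rintro ⟨x, hx, rfl⟩
    obtain ⟨v, w, rfl⟩ := exists_pluckerCoord_of_klein_eq_zero hx
    exact ⟨v, w, ofPlucker_pluckerCoord v w⟩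
  · rintro ⟨v, w, rfl⟩
    exact ⟨_, klein_pluckerCoord v w, ofPlucker_pluckerCoord v w⟩

theorem spannedByDecomposables_map_ofPlucker {F : Type*} [Field F]
    (M : Submodule F (Fin 6 → F)) :
    SpannedByDecomposables F (Fin 4 → F) (M.map (ofPlucker F)) ↔
      M = Submodule.span F ((M : Set (Fin 6 → F)) ∩ {x | klein x = 0}) := by
  rw [SpannedByDecomposables, ← ofPlucker_image_klein_eq_zero, Submodule.map_coe,
    ← Set.image_inter (ofPlucker_injective F), ← Submodule.map_span]
  exact (Submodule.map_injective_of_injective (ofPlucker_injective F)).eq_iff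

theorem finrank_map_ofPlucker {F : Type*} [Field F] (M : Submodule F (Fin 6 → F)) :
    finrank F (M.map (ofPlucker F)) = finrank F M :=
  (Submodule.equivMapOfInjective _ (ofPlucker_injective F) M).finrank_eq.symm

/-- Subspaces of the exterior square correspond to subspaces of the Plücker coordinate space. -/
theorem card_submodule_le_grade2 {F : Type*} [Field F]
    (P : Submodule F (ExteriorAlgebra F (Fin 4 → F)) → Prop) :
    Nat.card {L : Submodule F (ExteriorAlgebra F (Fin 4 → F)) // L ≤ grade2 F (Fin 4 → F) ∧ P L} =
      Nat.card {M : Submodule F (Fin 6 → F) // P (M.map (ofPlucker F))} := by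
  symm
  refine Nat.card_congr (Equiv.ofBijective (fun M => ⟨M.1.map (ofPlucker F), ?_, M.2⟩) ⟨?_, ?_⟩)
  · rw [← range_ofPlucker]
    exact LinearMap.map_le_range
  · intro M N h
    exact Subtype.ext (Submodule.map_injective_of_injective (ofPlucker_injective F)
      (congrArg Subtype.val h))
  · rintro ⟨L, hL, hP⟩
    have h : (L.comap (ofPlucker F)).map (ofPlucker F) = L :=
      Submodule.map_comap_eq_self (by rwa [range_ofPlucker])
    exact ⟨⟨L.comap (ofPlucker F), by rwa [h]⟩, Subtype.ext h⟩

theorem exists_not_spannedByDecomposables (F : Type*) [Field F] :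
    ∃ L : Submodule F (ExteriorAlgebra F (Fin 4 → F)),
      L ≤ grade2 F (Fin 4 → F) ∧ finrank F L = 3 ∧ ¬ SpannedByDecomposables F (Fin 4 → F) L := by
  let s : Fin 3 → Fin 6 → F :=
    ![![1, 0, 0, 0, 0, 1], ![0, 1, 0, 0, 0, 0], ![0, 0, 1, 0, 0, 0]]
  have hs : LinearIndependent F s := by
    rw [Fintype.linearIndependent_iff]
    intro c hc
    have h0 := congrFun hc 0
    have h1 := congrFun hc 1
    have h2 := congrFun hc 2
    simp [s, Fin.sum_univ_three] at h0 h1 h2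
    intro i
    fin_cases i <;> assumption
  refine ⟨(Submodule.span F (Set.range s)).map (ofPlucker F), ?_, ?_, ?_⟩
  · rw [← range_ofPlucker]
    exact LinearMap.map_le_range
  · rw [finrank_map_ofPlucker, finrank_span_eq_card hs, Fintype.card_fin]
  · rw [spannedByDecomposables_map_ofPlucker]
    intro h
    have hle : Submodule.span F (Set.range s) ≤ LinearMap.ker (LinearMap.proj (0 : Fin 6)) := by
      rw [h, Submodule.span_le]
      rintro x ⟨hx, hx0⟩
      obtain ⟨c, rfl⟩ := (Submodule.mem_span_range_iff_exists_fun F).1 hx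
      have : c 0 * c 0 = 0 := by simpa [klein, s, Fin.sum_univ_three] using hx0
      simpa [s, Fin.sum_univ_three] using this
    have : s 0 ∈ LinearMap.ker (LinearMap.proj (R := F) (φ := fun _ => F) (0 : Fin 6)) :=
      hle (Submodule.subset_span ⟨0, rfl⟩)
    simp [s] at this

end Exterior

section Counting

theorem span_range_coe_eq {F W : Type*} [Field F] [AddCommGroup W] [Module F W] {k : ℕ}
    {M : Submodule F W} (hM : finrank F M = k) [FiniteDimensional F M] {s : Fin k → W}
    (hs : LinearIndependent F s) (hsM : ∀ i, s i ∈ M) : Submodule.span F (Set.range s) = M := by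
  refine Submodule.eq_of_le_of_finrank_eq ?_ ?_
  · rw [Submodule.span_le]
    rintro _ ⟨i, rfl⟩
    exact hsM i
  · rw [finrank_span_eq_card hs, Fintype.card_fin, hM]

/-- Linearly independent families whose span satisfies `P` are ordered bases of subspaces
satisfying `P`. -/
def linearIndependentSpanEquiv {F W : Type*} [Field F] [AddCommGroup W] [Module F W]
    [FiniteDimensional F W] (k : ℕ) (P : Submodule F W → Prop) :
    {s : Fin k → W // LinearIndependent F s ∧ P (Submodule.span F (Set.range s))} ≃
      Σ M : {M : Submodule F W // finrank F M = k ∧ P M},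
        {s : Fin k → M.1 // LinearIndependent F s} where
  toFun s := ⟨⟨Submodule.span F (Set.range s.1),
    by rw [finrank_span_eq_card s.2.1, Fintype.card_fin], s.2.2⟩,
    ⟨fun i => ⟨s.1 i, Submodule.subset_span ⟨i, rfl⟩⟩,
      LinearIndependent.of_comp (Submodule.subtype _) s.2.1⟩⟩
  invFun t := ⟨fun i => (t.2.1 i : W), by
    have hli : LinearIndependent F fun i => (t.2.1 i : W) :=
      t.2.2.map' (Submodule.subtype _) (Submodule.ker_subtype _)
    refine ⟨hli, ?_⟩
    rw [span_range_coe_eq t.1.2.1 hli fun i => (t.2.1 i).2]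
    exact t.1.2.2⟩
  left_inv s := rfl
  right_inv := by
    rintro ⟨⟨M, hM, hP⟩, ⟨s, hs⟩⟩
    obtain ⟨s', hs', rfl⟩ : ∃ (s' : Fin k → W) (h : ∀ i, s' i ∈ M), s = fun i => ⟨s' i, h i⟩ :=
      ⟨fun i => s i, fun i => (s i).2, rfl⟩
    have hli : LinearIndependent F s' := hs.map' (Submodule.subtype _) (Submodule.ker_subtype _)
    obtain rfl := span_range_coe_eq hM hli hs'
    rfl

/-- Each `k`-dimensional subspace has the same number of ordered bases. -/
theorem card_linearIndependent_span {F W : Type*} [Field F] [Finite F] [AddCommGroup W]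
    [Module F W] [Finite W] (k : ℕ) (P : Submodule F W → Prop) :
    Nat.card {s : Fin k → W // LinearIndependent F s ∧ P (Submodule.span F (Set.range s))} =
      Nat.card {M : Submodule F W // finrank F M = k ∧ P M} *
        ∏ i : Fin k, (Nat.card F ^ k - Nat.card F ^ i.val) := by
  classical
  cases nonempty_fintype F
  cases nonempty_fintype W
  have := Fintype.ofFinite {M : Submodule F W // finrank F M = k ∧ P M}
  rw [Nat.card_congr (linearIndependentSpanEquiv k P), Nat.card_sigma,
    Finset.sum_congr rfl fun M _ => ?_, Finset.sum_const, Finset.card_univ, smul_eq_mul,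
    ← Nat.card_eq_fintype_card]
  have h := card_linearIndependent (K := F) (V := M.1) (k := k) M.2.1.ge
  rwa [M.2.1, ← Nat.card_eq_fintype_card] at h

theorem numAll_four_three_eq (p : ℕ) [Fact p.Prime] :
    numAll p 4 3 * ∏ i : Fin 3, (p ^ 3 - p ^ i.val) =
      Nat.card {s : Fin 3 → Fin 6 → ZMod p // LinearIndependent (ZMod p) s} := by
  have h := card_linearIndependent_span (F := ZMod p) (W := Fin 6 → ZMod p) 3 fun _ => True
  simp only [and_true, Nat.card_zmod] at h
  rw [h, numAll, card_submodule_le_grade2 (fun L => finrank (ZMod p) L = 3)]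
  simp only [finrank_map_ofPlucker]

theorem numSpanned_four_three_eq (p : ℕ) [Fact p.Prime] :
    numSpanned p 4 3 * ∏ i : Fin 3, (p ^ 3 - p ^ i.val) =
      Nat.card {s : Fin 3 → Fin 6 → ZMod p // LinearIndependent (ZMod p) s ∧
        Submodule.span (ZMod p) (Set.range s) = Submodule.span (ZMod p)
          ((Submodule.span (ZMod p) (Set.range s) : Set (Fin 6 → ZMod p)) ∩
            {x | klein x = 0})} := by
  have h := card_linearIndependent_span (F := ZMod p) (W := Fin 6 → ZMod p) 3 fun M =>
    M = Submodule.span (ZMod p) ((M : Set (Fin 6 → ZMod p)) ∩ {x | klein x = 0})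
  simp only [Nat.card_zmod] at h
  rw [h, numSpanned, card_submodule_le_grade2 (fun L => finrank (ZMod p) L = 3 ∧
    SpannedByDecomposables (ZMod p) (Fin 4 → ZMod p) L)]
  simp only [finrank_map_ofPlucker, spannedByDecomposables_map_ofPlucker]

theorem numAll_four_three_mul_le (p : ℕ) [Fact p.Prime] :
    numAll p 4 3 * ∏ i : Fin 3, (p ^ 3 - p ^ i.val) ≤ p ^ 18 := by
  rw [numAll_four_three_eq]
  refine (Finite.card_subtype_le _).trans_eq ?_
  simp [Nat.card_eq_fintype_card, ← pow_mul]

theorem le_numSpanned_four_three_mul (p : ℕ) [Fact p.Prime] (h2 : 2 < p) :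
    p ^ 18 ≤ numSpanned p 4 3 * ∏ i : Fin 3, (p ^ 3 - p ^ i.val) + 6 * p ^ 17 := by
  classical
  have h2' : (2 : ZMod p) ≠ 0 := by
    intro h
    have := (ZMod.natCast_eq_zero_iff 2 p).1 (by exact_mod_cast h)
    exact absurd (Nat.le_of_dvd two_pos this) (not_le.2 h2)
  have hzero := card_det_kleinGram_eq_zero_le h2'
  have hne : Nat.card {s : Fin 3 → Fin 6 → ZMod p // (kleinGram s).det ≠ 0} ≤
      numSpanned p 4 3 * ∏ i : Fin 3, (p ^ 3 - p ^ i.val) := by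
    rw [numSpanned_four_three_eq]
    refine Nat.card_le_card_of_injective (Subtype.map id fun s hs =>
      ⟨linearIndependent_of_det_kleinGram_ne_zero hs, span_eq_span_klein_eq_zero hs⟩)
      (Subtype.map_injective _ Function.injective_id)
  have htot : Nat.card {s : Fin 3 → Fin 6 → ZMod p // (kleinGram s).det = 0} +
      Nat.card {s : Fin 3 → Fin 6 → ZMod p // (kleinGram s).det ≠ 0} = p ^ 18 := by
    rw [← Nat.card_sum, Nat.card_congr (Equiv.sumCompl _)]
    simp [Nat.card_eq_fintype_card, ← pow_mul]
  rw [Nat.card_zmod] at hzero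
  omega

theorem prod_pow_sub_pow_pos {p : ℕ} (hp : 1 < p) (k : ℕ) :
    0 < ∏ i : Fin k, (p ^ k - p ^ i.val) :=
  Finset.prod_pos fun i _ => Nat.sub_pos_of_lt (Nat.pow_lt_pow_right hp i.isLt)

theorem numSpanned_four_three_le (p : ℕ) [Fact p.Prime] : numSpanned p 4 3 ≤ numAll p 4 3 := by
  refine le_of_mul_le_mul_right ?_ (prod_pow_sub_pow_pos (Fact.out : p.Prime).one_lt 3)
  rw [numSpanned_four_three_eq, numAll_four_three_eq]
  exact Nat.card_le_card_of_injective (Subtype.map id fun s hs => hs.1)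
    (Subtype.map_injective _ Function.injective_id)

theorem decompRatio_four_three_le_one (p : ℕ) [Fact p.Prime] : decompRatio p 4 3 ≤ 1 :=
  div_le_one_of_le₀ (by exact_mod_cast numSpanned_four_three_le p) (Nat.cast_nonneg _)

theorem one_sub_le_decompRatio_four_three (p : ℕ) [Fact p.Prime] (h6 : 6 < p) :
    1 - 6 / (p : ℝ) ≤ decompRatio p 4 3 := by
  have hc : (0 : ℝ) < (∏ i : Fin 3, (p ^ 3 - p ^ i.val) : ℕ) := by
    exact_mod_cast prod_pow_sub_pow_pos (Fact.out : p.Prime).one_lt 3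
  have hall : (numAll p 4 3 : ℝ) * (∏ i : Fin 3, (p ^ 3 - p ^ i.val) : ℕ) ≤ (p : ℝ) ^ 18 := by
    exact_mod_cast numAll_four_three_mul_le p
  have hsp : (p : ℝ) ^ 18 ≤
      (numSpanned p 4 3 : ℝ) * (∏ i : Fin 3, (p ^ 3 - p ^ i.val) : ℕ) + 6 * (p : ℝ) ^ 17 := by
    exact_mod_cast le_numSpanned_four_three_mul p (by omega)
  have hle : (numSpanned p 4 3 : ℝ) ≤ numAll p 4 3 := by
    exact_mod_cast numSpanned_four_three_le p
  generalize ((∏ i : Fin 3, (p ^ 3 - p ^ i.val) : ℕ) : ℝ) = c at hc hall hsp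
  have hp6 : (6 : ℝ) < p := by exact_mod_cast h6
  have hp : (0 : ℝ) < p := by linarith
  have hfac : (1 - 6 / (p : ℝ)) * (p : ℝ) ^ 18 = (p : ℝ) ^ 18 - 6 * (p : ℝ) ^ 17 := by
    field_simp
  have hpos : (0 : ℝ) < 1 - 6 / (p : ℝ) := by
    rw [sub_pos, div_lt_one hp]
    exact hp6
  have hS : (0 : ℝ) < numSpanned p 4 3 := by
    refine pos_of_mul_pos_left ?_ hc.le
    have := mul_pos hpos (pow_pos hp 18)
    linarith
  rw [decompRatio, le_div_iff₀ (hS.trans_le hle)]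
  refine le_of_mul_le_mul_right ?_ hc
  have := mul_le_mul_of_nonneg_left hall hpos.le
  linarith

theorem tendsto_one_sub_const_div (a : ℝ) :
    Tendsto (fun p : ℕ => 1 - a / (p : ℝ)) primesAtTop (nhds 1) := by
  have h := (tendsto_const_div_atTop_nhds_zero_nat a).const_sub 1
  rw [sub_zero] at h
  exact h.mono_left inf_le_left

theorem tendsto_decompRatio_four_three :
    Tendsto (fun p : ℕ => decompRatio p 4 3) primesAtTop (nhds 1) := by
  have hprime : ∀ᶠ p : ℕ in primesAtTop, p.Prime :=
    mem_inf_of_right (mem_principal_self _)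
  have hlarge : ∀ᶠ p : ℕ in primesAtTop, 6 < p := mem_inf_of_left (eventually_gt_atTop 6)
  refine tendsto_of_tendsto_of_tendsto_of_le_of_le' (tendsto_one_sub_const_div 6) tendsto_const_nhds ?_ ?_
  · filter_upwards [hprime, hlarge] with p hp h6
    have := Fact.mk hp
    exact one_sub_le_decompRatio_four_three p h6
  · filter_upwards [hprime] with p hp
    have := Fact.mk hp
    exact decompRatio_four_three_le_one p

end Counting

/-- for every prime `p > 2` there is a 3-dimensional subspace of
`⋀²(F_p^4)` not spanned by decomposables; nevertheless the proportion `R(p)` of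
3-dimensional subspaces spanned by decomposables satisfies
`lim_{p → ∞} R(p)/(1 - 1/p) = 1` along primes. -/
theorem stmt8 :
    (∀ p : ℕ, p.Prime → 2 < p →
        ∃ L : Submodule (ZMod p) (ExteriorAlgebra (ZMod p) (Fin 4 → ZMod p)),
          L ≤ grade2 (ZMod p) (Fin 4 → ZMod p) ∧ finrank (ZMod p) L = 3 ∧
          ¬ SpannedByDecomposables (ZMod p) (Fin 4 → ZMod p) L) ∧
      Tendsto (fun p : ℕ => decompRatio p 4 3 / (1 - 1 / (p : ℝ))) primesAtTop
        (nhds 1) := by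
  refine ⟨fun p hp _ => ?_, ?_⟩
  · have := Fact.mk hp
    exact exists_not_spannedByDecomposables (ZMod p)
  · have h := tendsto_decompRatio_four_three.div (tendsto_one_sub_const_div 1) one_ne_zero
    rwa [div_one] at h

end
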